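/- Let G be a graph on n vertices maximizing the number of induced copies of C5 among all n-vertex graphs, and suppose G is a blow-up of C5 (with five nonempty parts). Then G is a balanced blow-up of C5, i.e., G admits a partition into five nonempty parts realizing it as a blow-up of C5 in which any two part sizes differ by at most 1. -/

import Mathlib

/-- The 5-cycle on `Fin 5`. -/
def C5 : SimpleGraph (Fin 5) := SimpleGraph.fromRel (fun i j => j = i + 1)

/-- The number of induced copies of `H` in `G`. -/
noncomputable def inducedCopies {U V : Type} [Fintype U] [Fintype V]
    (H : SimpleGraph U) (G : SimpleGraph V) : ℕ :=
  Nat.card {s : Finset V // s.card = Fintype.card U ∧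
    Nonempty (G.induce (s : Set V) ≃g H)}

/-- The number of induced copies of the 5-cycle in `G`. -/
noncomputable def c5 {V : Type} [Fintype V] (G : SimpleGraph V) : ℕ :=
  inducedCopies C5 G

def RR (x : ℝ) : ℝ := x*(x+1)*(x+2)*(x+3)*(x+4)
def GG (x : ℝ) : ℝ := (x-1)*(x-2)*(x-3)*(x-4)

theorem poly1 (e : ℝ) (he : 0 ≤ e) : 0 < ((5+e)-1-1)*GG (5+e)*(RR (5+e+4*1) - RR (5+e) - 4*RR 1) - 5*1*(GG (5+e) - GG 1)*RR (5+e) := by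
  unfold RR GG
  ring_nf
  positivity
theorem poly2 (e : ℝ) (he : 0 ≤ e) : 0 < ((5+e)-2-1)*GG (5+e)*(RR (5+e+4*2) - RR (5+e) - 4*RR 2) - 5*2*(GG (5+e) - GG 2)*RR (5+e) := by
  unfold RR GG
  ring_nf
  positivity
theorem poly3 (e g : ℝ) (he : 0 ≤ e) (hg : 0 ≤ g) : 0 < ((5+g+e)-(3+g)-1)*GG (5+g+e)*(RR (5+g+e+4*(3+g)) - RR (5+g+e) - 4*RR (3+g)) - 5*(3+g)*(GG (5+g+e) - GG (3+g))*RR (5+g+e) := by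
  unfold RR GG
  ring_nf
  positivity

theorem Lstep (b t x : ℝ) (hb : 0 ≤ b) (ht : 0 ≤ t) (hx : 0 ≤ x) :
    0 ≤ RR (b+t+x) - RR (b+t) - RR (b+x) + RR b := by
  unfold RR
  ring_nf
  positivity

theorem Lmono (a b x y z : ℝ) (hb : 0 ≤ b) (ha : b ≤ a) (hx : b ≤ x) (hy : b ≤ y) (hz : b ≤ z) :
    RR (a+4*b) - RR a - 4*RR b ≤ RR (a+b+x+y+z) - RR a - RR b - RR x - RR y - RR z := by
  have h1 := Lstep b (a+3*b) (x-b) hb (by linarith) (by linarith)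
  have h2 := Lstep b (a+2*b+x) (y-b) hb (by linarith) (by linarith)
  have h3 := Lstep b (a+b+x+y) (z-b) hb (by linarith) (by linarith)
  ring_nf at h1 h2 h3 ⊢
  linarith

theorem poly_main (a b : ℕ) (hb : 1 ≤ b) (hab : b + 2 ≤ a) (ha : 5 ≤ a) :
    0 < ((a:ℝ)-b-1)*GG a*(RR (a+4*b) - RR a - 4*RR b) - 5*b*(GG a - GG b)*RR a := by
  rcases Nat.lt_or_ge b 3 with h | h
  · obtain ⟨e, rfl⟩ := Nat.exists_eq_add_of_le ha
    interval_cases b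
    · have := poly1 e (by positivity)
      push_cast; exact this
    · have := poly2 e (by positivity)
      push_cast; exact this
  · obtain ⟨g, rfl⟩ := Nat.exists_eq_add_of_le h
    obtain ⟨e, rfl⟩ := Nat.exists_eq_add_of_le hab
    have := poly3 e g (by positivity) (by positivity)
    push_cast
    have h5 : (3:ℝ)+g+2+e = 5+g+e := by ring
    rw [h5]; exact this

theorem num_rise (f : ℕ → ℝ) (hA : ∀ m : ℕ, ((m:ℝ)+5) * f m ≤ m * f (m+1))
    (m n : ℕ) (hm : 1 ≤ m) (hmn : m ≤ n) : f m * RR n ≤ f n * RR m := by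
  induction n, hmn using Nat.le_induction with
  | base => exact le_rfl
  | succ n hn ih =>
    have hn0 : (0:ℝ) < n := by exact_mod_cast (by omega : 0 < n)
    have hR : 0 ≤ RR m := by unfold RR; positivity
    have h1 := mul_le_mul_of_nonneg_right (hA n) hR
    have h2 : (n:ℝ) * RR ((n+1 : ℕ):ℝ) = (n+5) * RR n := by unfold RR; push_cast; ring
    refine le_of_mul_le_mul_left ?_ hn0
    have h3 := mul_le_mul_of_nonneg_left ih (by positivity : (0:ℝ) ≤ n+5)
    calc (n:ℝ) * (f m * RR ((n+1 : ℕ):ℝ)) = (n+5) * (f m * RR n) := by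
          rw [mul_left_comm, h2]; ring
      _ ≤ (n+5) * (f n * RR m) := h3
      _ ≤ n * (f (n+1) * RR m) := by linarith

theorem num_fall (f : ℕ → ℝ) (hB : ∀ m : ℕ, ((m:ℝ)-4) * f (m+1) ≤ (m+1) * f m) (hf : ∀ m, 0 ≤ f m)
    (b a : ℕ) (hb : 1 ≤ b) (hba : b ≤ a) : f a * (b * GG b) ≤ f b * (a * GG a) := by
  induction a, hba using Nat.le_induction with
  | base => exact le_rfl
  | succ n hn ih =>
    rcases Nat.lt_or_ge n 5 with h | h
    · have hz : GG b = 0 := by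
        unfold GG
        interval_cases n <;> interval_cases b <;> norm_num
      have hz' : 0 ≤ GG ((n+1:ℕ):ℝ) := by
        unfold GG
        interval_cases n <;> norm_num
      rw [hz]
      have := hf b
      simp only [mul_zero]
      positivity
    · have hn0 : (0:ℝ) < n-4 := by
        have : (5:ℝ) ≤ n := by exact_mod_cast h
        linarith
      have hG : 0 ≤ (b:ℝ) * GG b := by
        rcases Nat.lt_or_ge b 5 with h' | h'
        · unfold GG; interval_cases b <;> norm_num
        · obtain ⟨c, rfl⟩ := Nat.exists_eq_add_of_le h'
          unfold GG; push_cast; ring_nf; positivity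
      have h1 := mul_le_mul_of_nonneg_right (hB n) hG
      have h2 : ((n:ℝ)-4) * (((n+1 : ℕ):ℝ) * GG ((n+1 : ℕ):ℝ)) = (n+1) * (n * GG n) := by
        unfold GG; push_cast; ring
      refine le_of_mul_le_mul_left ?_ hn0
      have h3 := mul_le_mul_of_nonneg_left ih (by positivity : (0:ℝ) ≤ n+1)
      have h4 : ((n:ℝ)-4) * (f b * (((n+1 : ℕ):ℝ) * GG ((n+1 : ℕ):ℝ))) =
        f b * ((n+1) * (n * GG n)) := by rw [← h2]; ring
      rw [h4]
      linarith

theorem num_main (f : ℕ → ℝ) (hA : ∀ m : ℕ, ((m:ℝ)+5) * f m ≤ m * f (m+1))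
    (hB : ∀ m : ℕ, ((m:ℝ)-4) * f (m+1) ≤ (m+1) * f m) (hf : ∀ m, 0 ≤ f m)
    (h4 : ∀ m, m ≤ 4 → f m = 0) (a b x y z : ℕ) (hb : 1 ≤ b) (hab : b + 2 ≤ a)
    (hx : b ≤ x) (hy : b ≤ y) (hz : b ≤ z)
    (heq : f (a+b+x+y+z) = a*b*x*y*z + f a + f b + f x + f y + f z)
    (hmove : ((a:ℝ)-1)*(b+1)*x*y*z + f (a-1) + f (b+1) + f x + f y + f z ≤ f (a+b+x+y+z)) :
    False := by
  have hb0 : (0:ℝ) < b := by exact_mod_cast hb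
  have ha0 : (0:ℝ) < a := by exact_mod_cast (by omega : 0 < a)
  have hx0 : (0:ℝ) < x := by exact_mod_cast (by omega : 0 < x)
  have hy0 : (0:ℝ) < y := by exact_mod_cast (by omega : 0 < y)
  have hz0 : (0:ℝ) < z := by exact_mod_cast (by omega : 0 < z)
  have habR : (b:ℝ)+2 ≤ a := by exact_mod_cast hab
  have hA' := hA b
  obtain ⟨a', rfl⟩ : ∃ a', a = a'+1 := ⟨a-1, by omega⟩
  have hB' := hB a'
  simp only [Nat.add_sub_cancel] at hmove
  set a : ℕ := a'+1 with ha
  have ha' : (a':ℝ) = a - 1 := by rw [ha]; push_cast; ring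
  rw [ha'] at hB'
  set N := a+b+x+y+z with hN
  set q : ℝ := x*y*z with hq
  have hq0 : 0 < q := by positivity
  -- local inequality
  have hloc : q * (a-b-1) ≤ (f a - f a') - (f (b+1) - f b) := by
    have : (a:ℝ)*b*x*y*z = a*b*q := by rw [hq]; ring
    have h' : ((a:ℝ)-1)*(b+1)*x*y*z = (a-1)*(b+1)*q := by rw [hq]; ring
    rw [h'] at hmove; rw [this] at heq
    linarith
  have hloc2 : (a*b*q) * (a-b-1) ≤ 5*(b*f a - a*f b) := by
    have h1 := mul_le_mul_of_nonneg_left hloc (by positivity : (0:ℝ) ≤ a*b)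
    have h2 := mul_le_mul_of_nonneg_left hB' hb0.le
    have h3 := mul_le_mul_of_nonneg_left hA' ha0.le
    have h5 : (a:ℝ) - 1 + 1 = a := by ring
    rw [h5] at h2
    linarith
  set p : ℝ := a*b*q with hp
  have hp0 : 0 < p := by positivity
  rcases Nat.lt_or_ge a 5 with h | h
  · rw [h4 a (by omega)] at hloc2
    have := hf b
    have h6 : 0 < p * ((a:ℝ)-b-1) := mul_pos hp0 (by linarith)
    nlinarith [mul_nonneg ha0.le this]
  have ra := num_rise f hA a N (by omega) (by omega)
  have rb := num_rise f hA b N (by omega) (by omega)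
  have rx := num_rise f hA x N (by omega) (by omega)
  have ry := num_rise f hA y N (by omega) (by omega)
  have rz := num_rise f hA z N (by omega) (by omega)
  have hfall := num_fall f hB hf b a hb (by omega)
  have hpoly := poly_main a b hb hab h
  have hL := Lmono a b x y z hb0.le (by linarith) (by exact_mod_cast hx) (by exact_mod_cast hy) (by exact_mod_cast hz)
  have hNc : (N:ℝ) = a+b+x+y+z := by rw [hN]; push_cast; ring
  rw [← hNc] at hL
  set L : ℝ := RR (a+4*b) - RR a - 4*RR b with hLdef
  have hRN : 0 < RR N := by
    rw [hNc]; unfold RR; positivity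
  have hRa : 0 < RR a := by unfold RR; positivity
  have hRp : f N * L ≤ p * RR N := by
    have e1 : p = f N - f a - f b - f x - f y - f z := by
      rw [heq, hp, hq]; ring
    have h1 := mul_le_mul_of_nonneg_left hL (hf N)
    rw [e1]
    linarith
  have hGa : 0 < GG a := by
    obtain ⟨c, hc⟩ := Nat.exists_eq_add_of_le h
    rw [hc]; unfold GG; push_cast; ring_nf; positivity
  have hLpos : 0 ≤ L := by
    have h0 := Lstep 0 a (4*b) le_rfl ha0.le (by positivity)
    have h1 := Lstep 0 b (3*b) le_rfl hb0.le (by positivity)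
    have h2 := Lstep 0 b (2*b) le_rfl hb0.le (by positivity)
    have h3 := Lstep 0 b b le_rfl hb0.le hb0.le
    rw [hLdef]
    ring_nf at h0 h1 h2 h3 ⊢
    have hz0 : RR 0 = 0 := by unfold RR; ring
    rw [hz0] at h0 h1 h2 h3
    linarith
  have hfaL : f a * L ≤ p * RR a := by
    refine le_of_mul_le_mul_left ?_ hRN
    have h1 := mul_le_mul_of_nonneg_right ra hLpos
    have h2 := mul_le_mul_of_nonneg_right hRp hRa.le
    linarith
  have hdiff : 0 ≤ b * (GG a - GG b) := by
    refine mul_nonneg hb0.le ?_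
    have hmon : GG b ≤ GG a := by
      rcases Nat.lt_or_ge b 5 with h' | h'
      · have : GG b = 0 := by unfold GG; interval_cases b <;> norm_num
        rw [this]; exact hGa.le
      · have h5 : (5:ℝ) ≤ b := by exact_mod_cast h'
        obtain ⟨c, hc⟩ := Nat.exists_eq_add_of_le h'
        obtain ⟨t, ht⟩ := Nat.exists_eq_add_of_le (by omega : b ≤ a)
        have hcR : (b:ℝ) = 5 + c := by rw [hc]; push_cast; ring
        have htR : (a:ℝ) = 5 + c + t := by rw [ht]; push_cast; rw [hcR]
        rw [htR, hcR]
        rw [← sub_nonneg]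
        unfold GG
        ring_nf
        positivity
    linarith
  have s1 : p * (a-b-1) * GG a ≤ 5 * (b * (GG a - GG b)) * f a := by
    have h1 := mul_le_mul_of_nonneg_right hloc2 hGa.le
    linarith
  have s2 := mul_le_mul_of_nonneg_right s1 hLpos
  have s3 := mul_le_mul_of_nonneg_left hfaL (mul_nonneg (by norm_num : (0:ℝ) ≤ 5) hdiff)
  have s4 := mul_pos hp0 hpoly
  linarith

def adjB (a b : Fin 5) : Bool := b == a + 1 || a == b + 1
def chk (a b c d e : Fin 5) : Bool :=
  (a == b || adjB a b) && (b == c || adjB b c) && (c == d || adjB c d) && (d == e || adjB d e) && (e == a || adjB e a) &&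
  (a == c || !adjB a c) && (b == d || !adjB b d) && (c == e || !adjB c e) && (d == a || !adjB d a) && (e == b || !adjB e b)
def concl (a b c d e : Fin 5) : Bool :=
  (a == b && a == c && a == d && a == e) ||
  (a != b && a != c && a != d && a != e && b != c && b != d && b != e && c != d && c != e && d != e)
theorem C5dec : ∀ a b c d e : Fin 5, (!chk a b c d e || concl a b c d e) = true := by
  decide +kernel

theorem C5_adj (i j : Fin 5) : C5.Adj i j ↔ adjB i j = true := by
  simp only [C5, SimpleGraph.fromRel_adj, adjB]
  revert i j; decide

theorem C5_prime (q : Fin 5 → Fin 5)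
    (h : ∀ i j, q i ≠ q j → (C5.Adj i j ↔ C5.Adj (q i) (q j))) :
    (∀ i j, q i = q j) ∨ Function.Injective q := by
  simp only [C5_adj] at h
  have hd := C5dec (q 0) (q 1) (q 2) (q 3) (q 4)
  have hc : chk (q 0) (q 1) (q 2) (q 3) (q 4) = true := by
    have k1 : ∀ i j, adjB i j = true → (q i == q j || adjB (q i) (q j)) = true := by
      intro i j hij
      by_cases e : q i = q j
      · simp [e]
      · simp [(h i j e).1 hij]
    have k2 : ∀ i j, adjB i j = false → (q i == q j || !adjB (q i) (q j)) = true := by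
      intro i j hij
      by_cases e : q i = q j
      · simp [e]
      · have := (h i j e)
        rw [hij] at this
        simp at this
        simp [this]
    simp only [chk, Bool.and_eq_true]
    refine ⟨⟨⟨⟨⟨⟨⟨⟨⟨k1 _ _ ?_, k1 _ _ ?_⟩, k1 _ _ ?_⟩, k1 _ _ ?_⟩, k1 _ _ ?_⟩, k2 _ _ ?_⟩, k2 _ _ ?_⟩, k2 _ _ ?_⟩, k2 _ _ ?_⟩, k2 _ _ ?_⟩ <;> decide
  rw [hc] at hd
  simp [concl] at hd
  rcases hd with hd | hd
  · left
    obtain ⟨⟨⟨h1, h2⟩, h3⟩, h4⟩ := hd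
    have : ∀ i, q i = q 0 := by
      intro i; fin_cases i <;> simp [*] <;> simp [← h1,← h2,← h3,← h4]
    intro i j; rw [this i, this j]
  · right
    intro i j hij
    fin_cases i <;> fin_cases j <;> simp_all

open Classical in
/-- The finset of vertex sets of induced copies. -/
noncomputable def copies {V : Type} [Fintype V] (G : SimpleGraph V) : Finset (Finset V) :=
  Finset.univ.filter (fun s => ∃ φ : C5 ↪g G, Finset.univ.map φ.toEmbedding = s)

theorem mem_copies {V : Type} [Fintype V] {G : SimpleGraph V} {s : Finset V} :
    s ∈ copies G ↔ ∃ φ : C5 ↪g G, Finset.univ.map φ.toEmbedding = s := by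
  simp [copies]

theorem c5_eq {V : Type} [Fintype V] (G : SimpleGraph V) : c5 G = (copies G).card := by
  classical
  unfold c5 inducedCopies
  rw [← Fintype.card_coe, ← Nat.card_eq_fintype_card (α := ↥(copies G))]
  apply Nat.card_congr
  apply Equiv.subtypeEquivRight
  intro s
  rw [mem_copies]
  constructor
  · rintro ⟨_, ⟨e⟩⟩
    refine ⟨e.symm.toEmbedding.trans (SimpleGraph.Embedding.induce _), ?_⟩
    ext v
    simp only [Finset.mem_map, Finset.mem_univ, true_and]
    constructor
    · rintro ⟨i, rfl⟩
      exact (e.symm i).2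
    · intro hv
      refine ⟨e ⟨v, hv⟩, ?_⟩
      change ((e.symm (e ⟨v, hv⟩) : _) : V) = v
      simp
  · rintro ⟨φ, rfl⟩
    refine ⟨by simp, ⟨?_⟩⟩
    refine RelIso.symm ⟨Equiv.ofBijective (fun i => ⟨φ i, by simp⟩) ⟨?_, ?_⟩, ?_⟩
    · intro i j hij
      simpa using hij
    · rintro ⟨v, hv⟩
      simp at hv
      obtain ⟨i, rfl⟩ := hv
      exact ⟨i, rfl⟩
    · intro i j
      exact φ.map_adj_iff

theorem card_of_mem_copies {V : Type} [Fintype V] {G : SimpleGraph V} {s : Finset V}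
    (h : s ∈ copies G) : s.card = 5 := by
  obtain ⟨φ, rfl⟩ := mem_copies.1 h
  simp

theorem map_mem_copies {V W : Type} [Fintype V] [Fintype W] {G : SimpleGraph V}
    {H : SimpleGraph W} (ψ : G ↪g H) {s : Finset V}
    (h : s ∈ copies G) : s.map ψ.toEmbedding ∈ copies H := by
  obtain ⟨φ, rfl⟩ := mem_copies.1 h
  refine mem_copies.2 ⟨φ.trans ψ, ?_⟩
  rw [Finset.map_map]
  rfl

theorem copies_le {V W : Type} [Fintype V] [Fintype W] {G : SimpleGraph V}
    {H : SimpleGraph W} (ψ : G ↪g H) : c5 G ≤ c5 H := by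
  classical
  rw [c5_eq, c5_eq]
  refine Finset.card_le_card_of_injOn (fun s => s.map ψ.toEmbedding)
    (fun s hs => map_mem_copies ψ hs) ?_
  intro s _ t _ h
  exact Finset.map_injective _ h

/-- Copies inside an induced subgraph. -/
theorem c5_induce {V : Type} [Fintype V] (G : SimpleGraph V) (p : V → Prop)
    [Fintype {v // p v}] [DecidablePred fun s : Finset V => ∀ v ∈ s, p v] :
    c5 (G.comap (Subtype.val : {v // p v} → V)) =
      ((copies G).filter (fun s => ∀ v ∈ s, p v)).card := by
  classical
  rw [c5_eq]
  let ψ : G.comap (Subtype.val : {v // p v} → V) ↪g G :=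
    SimpleGraph.Embedding.comap (Function.Embedding.subtype p) G
  have hψ : ∀ x, ψ x = x.1 := fun x => rfl
  refine Finset.card_bij (fun s _ => s.map ψ.toEmbedding) ?_ ?_ ?_
  · intro s hs
    rw [Finset.mem_filter]
    refine ⟨map_mem_copies ψ hs, ?_⟩
    intro v hv
    obtain ⟨x, _, rfl⟩ := Finset.mem_map.1 hv
    exact x.2
  · intro s _ t _ h
    exact Finset.map_injective _ h
  · intro s hs
    rw [Finset.mem_filter] at hs
    obtain ⟨φ, rfl⟩ := mem_copies.1 hs.1
    have h2 : ∀ i, p (φ i) := fun i => hs.2 _ (by simp)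
    let χ : C5 ↪g G.comap (Subtype.val : {v // p v} → V) :=
      ⟨⟨fun i => ⟨φ i, h2 i⟩, fun i j h => φ.injective (congrArg Subtype.val h)⟩, by
        intro i j
        exact φ.map_adj_iff⟩
    refine ⟨_, mem_copies.2 ⟨χ, rfl⟩, ?_⟩
    rw [Finset.map_map]
    rfl

/-- The extremal function. -/
noncomputable def exF (m : ℕ) : ℕ :=
  sSup (Set.range fun G : SimpleGraph (Fin m) => c5 G)

theorem exF_eq (m : ℕ) : exF m = sSup (Set.range fun G : SimpleGraph (Fin m) => c5 G) := by
  rfl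

theorem le_exF_fin {m : ℕ} (G : SimpleGraph (Fin m)) : c5 G ≤ exF m := by
  rw [exF_eq]
  exact le_csSup (Set.finite_range _).bddAbove ⟨G, rfl⟩

theorem exF_attained (m : ℕ) : ∃ G : SimpleGraph (Fin m), c5 G = exF m := by
  rw [exF_eq]
  have := Nat.sSup_mem (Set.range_nonempty fun G : SimpleGraph (Fin m) => c5 G)
    (Set.finite_range _).bddAbove
  exact this

theorem le_exF {V : Type} [Fintype V] (G : SimpleGraph V) {m : ℕ} (hm : Fintype.card V = m) :
    c5 G ≤ exF m := by
  let e : Fin m ≃ V := (Fintype.equivFinOfCardEq hm).symm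
  refine le_trans (copies_le (SimpleGraph.Iso.comap e G).symm.toEmbedding) (le_exF_fin _)

theorem exF_small (m : ℕ) (hm : m ≤ 4) : exF m = 0 := by
  obtain ⟨G, hG⟩ := exF_attained m
  rw [← hG, c5_eq, Finset.card_eq_zero, Finset.eq_empty_iff_forall_notMem]
  intro s hs
  have h1 := card_of_mem_copies hs
  have h2 := Finset.card_le_univ s
  simp at h2
  omega

theorem sum_deg {V : Type} [Fintype V] [DecidableEq V] (G : SimpleGraph V) :
    ∑ v : V, ((copies G).filter (fun s => v ∈ s)).card = 5 * c5 G := by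
  have := Finset.sum_card_bipartiteAbove_eq_sum_card_bipartiteBelow
    (s := (Finset.univ : Finset V)) (t := copies G) (fun v s => v ∈ s)
  simp only [Finset.bipartiteAbove, Finset.bipartiteBelow] at this
  rw [this, c5_eq]
  rw [Finset.sum_congr rfl (g := fun _ => 5)]
  · simp [mul_comm]
  · intro s hs
    simpa using card_of_mem_copies hs

theorem exF_B (m : ℕ) : ((m:ℝ) - 4) * exF (m+1) ≤ (m+1) * exF m := by
  classical
  obtain ⟨G, hG⟩ := exF_attained (m+1)
  have h1 : ∀ v : Fin (m+1), c5 G ≤ exF m + ((copies G).filter (fun s => v ∈ s)).card := by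
    intro v
    have h2 := c5_induce G (fun u => u ≠ v)
    have h3 : c5 (G.comap (Subtype.val : {u // u ≠ v} → Fin (m+1))) ≤ exF m :=
      le_exF _ (by simp)
    have h4 : ((copies G).filter (fun s => ∀ u ∈ s, u ≠ v)) =
        (copies G).filter (fun s => ¬ v ∈ s) := by
      apply Finset.filter_congr
      intro s _
      exact ⟨fun h hv => h v hv rfl, fun h u hu e => h (e ▸ hu)⟩
    rw [h4] at h2
    have h5 := Finset.card_filter_add_card_filter_not (s := copies G) (fun s => v ∈ s)
    rw [c5_eq G]
    omega
  have h6 := Finset.sum_le_sum (s := Finset.univ) (fun v _ => h1 v)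
  rw [Finset.sum_add_distrib, sum_deg] at h6
  simp at h6
  rw [hG] at h6
  have h7 : ((m:ℝ)+1) * exF (m+1) ≤ (m+1) * exF m + 5 * exF (m+1) := by exact_mod_cast h6
  linarith

theorem exF_A (m : ℕ) : ((m:ℝ) + 5) * exF m ≤ m * exF (m+1) := by
  classical
  obtain ⟨G, hG⟩ := exF_attained m
  have h1 : ∀ v : Fin m, c5 G + ((copies G).filter (fun s => v ∈ s)).card ≤ exF (m+1) := by
    intro v
    let π : Option (Fin m) → Fin m := fun o => o.getD v
    let H := G.comap π
    have h2 : c5 H ≤ exF (m+1) := le_exF _ (by simp)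
    refine le_trans ?_ h2
    let ψ0 : G ↪g H := ⟨⟨some, Option.some_injective _⟩, by intro a b; rfl⟩
    let σ : Fin m → Option (Fin m) := fun u => if u = v then none else some u
    have hσ : ∀ u, π (σ u) = u := by
      intro u
      by_cases h : u = v
      · simp [σ, π, h]
      · simp [σ, π, h]
    let ψ1 : G ↪g H := ⟨⟨σ, Function.LeftInverse.injective hσ⟩, by
      intro a b
      change G.Adj (π (σ a)) (π (σ b)) ↔ _
      rw [hσ, hσ]⟩
    rw [c5_eq, c5_eq]
    have hd : Disjoint ((copies G).image (fun s => s.map ψ0.toEmbedding))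
        (((copies G).filter (fun s => v ∈ s)).image (fun s => s.map ψ1.toEmbedding)) := by
      rw [Finset.disjoint_left]
      intro t ht ht'
      obtain ⟨s, _, rfl⟩ := Finset.mem_image.1 ht
      obtain ⟨s', hs', he⟩ := Finset.mem_image.1 ht'
      have hn : (none : Option (Fin m)) ∈ s'.map ψ1.toEmbedding := by
        refine Finset.mem_map.2 ⟨v, (Finset.mem_filter.1 hs').2, ?_⟩
        change σ v = none
        simp [σ]
      rw [he] at hn
      obtain ⟨u, _, hu⟩ := Finset.mem_map.1 hn
      exact Option.some_ne_none u hu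
    rw [← Finset.card_image_of_injective (copies G) (Finset.map_injective ψ0.toEmbedding),
      ← Finset.card_image_of_injective ((copies G).filter (fun s => v ∈ s))
        (Finset.map_injective ψ1.toEmbedding), ← Finset.card_union_of_disjoint hd]
    apply Finset.card_le_card
    intro t ht
    rcases Finset.mem_union.1 ht with ht | ht
    · obtain ⟨s, hs, rfl⟩ := Finset.mem_image.1 ht
      exact map_mem_copies ψ0 hs
    · obtain ⟨s, hs, rfl⟩ := Finset.mem_image.1 ht
      exact map_mem_copies ψ1 (Finset.mem_filter.1 hs).1
  have h6 := Finset.sum_le_sum (s := Finset.univ) (fun v _ => h1 v)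
  rw [Finset.sum_add_distrib, sum_deg] at h6
  simp at h6
  rw [hG] at h6
  have h7 : (m:ℝ) * exF m + 5 * exF m ≤ m * exF (m+1) := by exact_mod_cast h6
  linarith

/-- Counting in a blow-up. -/
theorem c5_blowup {V : Type} [Fintype V] (G : SimpleGraph V) (P : V → Fin 5)
    (hP : ∀ u v, P u ≠ P v → (G.Adj u v ↔ C5.Adj (P u) (P v))) :
    c5 G = ∏ i, Nat.card {v // P v = i} +
      ∑ i, c5 (G.comap (Subtype.val : {v // P v = i} → V)) := by
  classical
  simp only [c5_induce]
  rw [c5_eq]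
  have hT : ∀ t : (i : Fin 5) → {v // P v = i}, ∃ φ : C5 ↪g G, ∀ i, φ i = (t i).1 := by
    intro t
    refine ⟨⟨⟨fun i => (t i).1, ?_⟩, ?_⟩, fun i => rfl⟩
    · intro i j h
      have := congrArg P h
      simpa [(t i).2, (t j).2] using this
    · intro i j
      change G.Adj (t i).1 (t j).1 ↔ _
      by_cases h : i = j
      · subst h; simp
      · rw [hP _ _ (by rw [(t i).2, (t j).2]; exact h), (t i).2, (t j).2]
  let T : ((i : Fin 5) → {v // P v = i}) → Finset V := fun t => Finset.univ.image (fun i => (t i).1)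
  have hTinj : Function.Injective T := by
    intro t t' h
    funext i
    have h1 : (t i).1 ∈ T t' := by rw [← h]; exact Finset.mem_image_of_mem _ (Finset.mem_univ i)
    obtain ⟨j, _, hj⟩ := Finset.mem_image.1 h1
    have hji : j = i := by
      have := congrArg P hj
      simpa [(t i).2, (t' j).2] using this
    subst hji
    exact Subtype.ext hj.symm
  have hTcard : (Finset.univ.image T).card = ∏ i, Nat.card {v // P v = i} := by
    rw [Finset.card_image_of_injective _ hTinj, Finset.card_univ, Fintype.card_pi]
    simp [Nat.card_eq_fintype_card]
  have hcop : copies G = Finset.univ.image T ∪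
      Finset.univ.biUnion (fun i => (copies G).filter (fun s => ∀ v ∈ s, P v = i)) := by
    ext s
    simp only [Finset.mem_union, Finset.mem_image, Finset.mem_univ, true_and, Finset.mem_biUnion,
      Finset.mem_filter]
    constructor
    · intro hs
      obtain ⟨φ, hφ⟩ := mem_copies.1 hs
      rcases C5_prime (fun i => P (φ i)) (by
        intro i j hij
        rw [← hP _ _ hij, φ.map_adj_iff]) with h | h
      · right
        refine ⟨P (φ 0), hs, ?_⟩
        intro v hv
        rw [← hφ] at hv
        obtain ⟨i, _, rfl⟩ := Finset.mem_map.1 hv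
        exact h i 0
      · left
        let e : Fin 5 ≃ Fin 5 := Equiv.ofBijective _ (Finite.injective_iff_bijective.1 h)
        have he : ∀ i, P (φ (e.symm i)) = i := fun i => e.apply_symm_apply i
        refine ⟨fun i => ⟨φ (e.symm i), he i⟩, ?_⟩
        rw [← hφ]
        ext v
        simp only [T, Finset.mem_image, Finset.mem_map, Finset.mem_univ, true_and]
        constructor
        · rintro ⟨i, rfl⟩
          exact ⟨e.symm i, rfl⟩
        · rintro ⟨i, rfl⟩
          refine ⟨e i, ?_⟩
          rw [Equiv.symm_apply_apply]
          rfl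
    · rintro (⟨t, rfl⟩ | ⟨i, h, _⟩)
      · obtain ⟨φ, hφ⟩ := hT t
        refine mem_copies.2 ⟨φ, ?_⟩
        ext v
        simp only [T, Finset.mem_image, Finset.mem_map, Finset.mem_univ, true_and]
        exact exists_congr fun i => by rw [← hφ i]; rfl
      · exact h
  have hd : Disjoint (Finset.univ.image T)
      (Finset.univ.biUnion (fun i => (copies G).filter (fun s => ∀ v ∈ s, P v = i))) := by
    rw [Finset.disjoint_left]
    intro s hs hs'
    obtain ⟨t, _, rfl⟩ := Finset.mem_image.1 hs
    obtain ⟨i, _, hi⟩ := Finset.mem_biUnion.1 hs'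
    have hi' := (Finset.mem_filter.1 hi).2
    have h0 := hi' (t 0).1 (Finset.mem_image_of_mem _ (Finset.mem_univ 0))
    have h1 := hi' (t 1).1 (Finset.mem_image_of_mem _ (Finset.mem_univ 1))
    rw [(t 0).2] at h0
    rw [(t 1).2, ← h0] at h1
    exact absurd h1 (by decide)
  conv_lhs => rw [hcop]
  rw [Finset.card_union_of_disjoint hd, hTcard, Finset.card_biUnion]
  intro i _ j _ hij
  rw [Function.onFun, Finset.disjoint_left]
  intro s hs hs'
  rw [Finset.mem_filter] at hs hs'
  have hc := card_of_mem_copies hs.1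
  obtain ⟨v, hv⟩ := Finset.card_pos.1 (by omega : 0 < s.card)
  exact hij ((hs.2 v hv).symm.trans (hs'.2 v hv))

theorem blowup_upper {V : Type} [Fintype V] (G : SimpleGraph V) (P : V → Fin 5)
    (hP : ∀ u v, P u ≠ P v → (G.Adj u v ↔ C5.Adj (P u) (P v))) :
    c5 G ≤ ∏ i, Nat.card {v // P v = i} + ∑ i, exF (Nat.card {v // P v = i}) := by
  classical
  rw [c5_blowup G P hP]
  gcongr with i
  exact le_exF _ (by rw [Nat.card_eq_fintype_card])

theorem blowup_lower (x : Fin 5 → ℕ) :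
    ∏ i, x i + ∑ i, exF (x i) ≤ exF (∑ i, x i) := by
  classical
  choose H hH using fun i => exF_attained (x i)
  let G : SimpleGraph (Σ i, Fin (x i)) :=
    { Adj := fun u v => if h : u.1 = v.1 then (H v.1).Adj (h ▸ u.2) v.2 else C5.Adj u.1 v.1
      symm := by
        constructor
        rintro ⟨i, u⟩ ⟨j, v⟩ h
        by_cases hij : i = j
        · subst hij
          simp at h ⊢
          exact h.symm
        · have hji : ¬ j = i := fun e => hij e.symm
          simp only [hij, hji, dite_false] at h ⊢
          exact h.symm
      loopless := by
        constructor
        rintro ⟨i, u⟩ h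
        simp at h }
  have h1 : c5 G ≤ exF (∑ i, x i) := le_exF G (by simp)
  refine le_trans ?_ h1
  rw [c5_blowup G Sigma.fst (by
    intro u v huv
    simp [G, huv])]
  have hc : ∀ i, Nat.card {v : Σ i, Fin (x i) // v.1 = i} = x i := by
    intro i
    have e : Fin (x i) ≃ {v : Σ i, Fin (x i) // v.1 = i} :=
      Equiv.ofBijective (fun u => ⟨⟨i, u⟩, rfl⟩) ⟨fun u v h => by simpa using h, by
        rintro ⟨⟨j, u⟩, h⟩
        simp only at h
        subst h
        exact ⟨u, rfl⟩⟩
    rw [← Nat.card_congr e]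
    simp
  simp only [hc]
  gcongr with i
  rw [← hH i]
  refine copies_le ⟨⟨fun u => ⟨⟨i, u⟩, rfl⟩, ?_⟩, ?_⟩
  · intro u v h
    simpa using h
  · intro u v
    change (if h : i = i then (H i).Adj (h ▸ u) v else C5.Adj i i) ↔ _
    simp

theorem exists_perm (i j : Fin 5) (hij : i ≠ j) :
    ∃ e : Equiv.Perm (Fin 5), e 0 = i ∧ e 1 = j := by
  refine ⟨Equiv.swap (Equiv.swap 0 i 1) j * Equiv.swap 0 i, ?_, ?_⟩
  · have h1 : i ≠ Equiv.swap 0 i 1 := by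
      intro h
      have : Equiv.swap 0 i 0 = Equiv.swap 0 i 1 := by rw [Equiv.swap_apply_left]; exact h
      exact absurd ((Equiv.swap 0 i).injective this) (by decide)
    simp only [Equiv.Perm.mul_apply, Equiv.swap_apply_left]
    exact Equiv.swap_apply_of_ne_of_ne h1 hij
  · simp only [Equiv.Perm.mul_apply, Equiv.swap_apply_left]

/-- If `G` on `n` vertices maximizes the number of induced copies of `C5` and is a
blow-up of `C5` with five nonempty parts (the fibers of a surjection `P : V(G) → Fin 5`
with complete/empty bipartite graphs between distinct parts according to `C5`), then `G`
admits such a partition in which any two part sizes differ by at most one. -/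
theorem extremal_blowup_is_balanced (n : ℕ) (G : SimpleGraph (Fin n))
    (hext : ∀ G' : SimpleGraph (Fin n), c5 G' ≤ c5 G)
    (hblow : ∃ P : Fin n → Fin 5, Function.Surjective P ∧
      ∀ u v : Fin n, P u ≠ P v → (G.Adj u v ↔ C5.Adj (P u) (P v))) :
    ∃ P : Fin n → Fin 5, Function.Surjective P ∧
      (∀ u v : Fin n, P u ≠ P v → (G.Adj u v ↔ C5.Adj (P u) (P v))) ∧
      ∀ i j : Fin 5, Nat.card {v : Fin n // P v = i} ≤ Nat.card {v : Fin n // P v = j} + 1 := by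
  classical
  obtain ⟨P, hsurj, hP⟩ := hblow
  refine ⟨P, hsurj, hP, ?_⟩
  by_contra hcon
  push Not at hcon
  obtain ⟨i, j0, hij0⟩ := hcon
  let w : Fin 5 → ℕ := fun i => Nat.card {v : Fin n // P v = i}
  obtain ⟨j, -, hj⟩ := Finset.exists_min_image Finset.univ w ⟨0, Finset.mem_univ _⟩
  have hmin : ∀ k, w j ≤ w k := fun k => hj k (Finset.mem_univ k)
  have hij : w j + 2 ≤ w i := by
    have h1 : w j0 + 1 < w i := hij0
    have := hmin j0
    omega
  have hpos : 1 ≤ w j := by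
    obtain ⟨v, hv⟩ := hsurj j
    have : Nonempty {v : Fin n // P v = j} := ⟨⟨v, hv⟩⟩
    exact Nat.card_pos
  have hne : i ≠ j := by
    rintro rfl
    omega
  obtain ⟨e, he0, he1⟩ := exists_perm i j hne
  have hsum : ∑ k, w k = n := by
    have h := Fintype.card_congr (Equiv.sigmaFiberEquiv P)
    rw [Fintype.card_sigma, Fintype.card_fin] at h
    simpa [w, Nat.card_eq_fintype_card] using h
  have hcn : c5 G = exF n := by
    obtain ⟨G', hG'⟩ := exF_attained n
    exact le_antisymm (le_exF_fin G) (hG' ▸ hext G')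
  have hup : exF n ≤ ∏ k, w k + ∑ k, exF (w k) := hcn ▸ blowup_upper G P hP
  have hlow := blowup_lower w
  rw [hsum] at hlow
  have hmv := blowup_lower ![w (e 0) - 1, w (e 1) + 1, w (e 2), w (e 3), w (e 4)]
  rw [← Equiv.sum_comp e] at hsum
  rw [← Equiv.prod_comp e, ← Equiv.sum_comp e] at hup hlow
  simp only [Fin.prod_univ_five, Fin.sum_univ_five] at hup hlow hmv hsum
  rw [he0, he1] at hup hlow hmv hsum
  simp only [Matrix.cons_val] at hmv
  have hs2 : w i - 1 + (w j + 1) + w (e 2) + w (e 3) + w (e 4) = n := by omega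
  rw [hs2] at hmv
  have heq := le_antisymm hup hlow
  refine num_main (fun m => (exF m : ℝ)) exF_A exF_B (fun m => Nat.cast_nonneg _)
    (fun m hm => by simp [exF_small m hm]) (w i) (w j) (w (e 2)) (w (e 3)) (w (e 4)) hpos hij
    (hmin _) (hmin _) (hmin _) ?_ ?_
  · rw [hsum, heq]
    push_cast
    ring
  · rw [hsum]
    have h1 : ((w i - 1 : ℕ) : ℝ) = (w i : ℝ) - 1 := by
      rw [Nat.cast_sub (by omega)]; simp
    rw [← h1]
    refine le_trans (le_of_eq ?_) (Nat.cast_le (α := ℝ).2 hmv)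
    push_cast
    ring
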